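/- arXiv:2011.01273 — 3 statements merged into one kernel-verified Lean document; each statement's English description precedes it below -/
import Mathlib

section
/- The principle ▽ holds for every separative poset if and only if it holds for every poset of the form B ∖ {0} where B is a complete Boolean algebra. That is: every separative poset P admits a dense sub-poset D with |{q ∈ D : p ≤ q}| < S(P) for all p ∈ P, if and only if for every complete Boolean algebra B the poset of nonzero elements of B admits a dense sub-poset D with |{q ∈ D : p ≤ q}| < S(B ∖ {0}) for every nonzero p ∈ B. -/
open Cardinal

universe u

/-- `a` and `b` are compatible with respect to the extension relation `le`:
they have a common extension. -/
def RelCompat {P : Type*} (le : P → P → Prop) (a b : P) : Prop :=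
  ∃ r, le r a ∧ le r b

/-- A poset (with `le q p` meaning "`q` extends `p`") is separative if whenever
`q` does not extend `p` there is an extension of `q` incompatible with `p`. -/
def RelSeparative {P : Type*} (le : P → P → Prop) : Prop :=
  ∀ p q, ¬ le q p → ∃ r, le r q ∧ ¬ RelCompat le r p

/-- An antichain: a set of pairwise incompatible elements. -/
def RelAntichain {P : Type*} (le : P → P → Prop) (A : Set P) : Prop :=
  A.Pairwise fun a b => ¬ RelCompat le a b

/-- `D` is dense: every element has an extension in `D`. -/
def RelDense {P : Type*} (le : P → P → Prop) (D : Set P) : Prop :=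
  ∀ p, ∃ d ∈ D, le d p

/-- The Souslin number of a poset: the least cardinal `κ` such that the poset has no
antichain of cardinality `κ`. -/
noncomputable def RelSouslin {P : Type u} (le : P → P → Prop) : Cardinal.{u} :=
  sInf { κ : Cardinal.{u} | ∀ A : Set P, RelAntichain le A → #A ≠ κ }

/-- The principle ▽ for a poset: there is a dense subset `D` such that each `p` extends
fewer than `S(P)` many members of `D`. -/
def RelNabla {P : Type u} (le : P → P → Prop) : Prop :=
  ∃ D : Set P, RelDense le D ∧ ∀ p : P, #({ q ∈ D | le p q } : Set P) < RelSouslin le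

/-- The regular elements of a complete Heyting algebra form a complete Boolean algebra. -/
instance Heyting.Regular.instCompleteBooleanAlgebra {α : Type*} [Order.Frame α] :
    CompleteBooleanAlgebra (Heyting.Regular α) where
  __ := (inferInstance : BooleanAlgebra (Heyting.Regular α))
  sSup := (Heyting.Regular.gi (α := α)).liftCompleteLattice.sSup
  isLUB_sSup := (Heyting.Regular.gi (α := α)).liftCompleteLattice.isLUB_sSup
  sInf := (Heyting.Regular.gi (α := α)).liftCompleteLattice.sInf
  isGLB_sInf := (Heyting.Regular.gi (α := α)).liftCompleteLattice.isGLB_sInf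

section DenseEmbedding

variable {P Q : Type u} [PartialOrder P] [PartialOrder Q] (e : P ↪o Q)

theorem RelAntichain.image_orderEmbedding (hd : ∀ q, ∃ p, e p ≤ q) {A : Set P}
    (hA : RelAntichain (· ≤ ·) A) : RelAntichain (· ≤ ·) (e '' A) := by
  rintro _ ⟨a, ha, rfl⟩ _ ⟨b, hb, rfl⟩ hne ⟨q, hqa, hqb⟩
  obtain ⟨p, hp⟩ := hd q
  exact hA ha hb (ne_of_apply_ne e hne)
    ⟨p, e.le_iff_le.1 (hp.trans hqa), e.le_iff_le.1 (hp.trans hqb)⟩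

variable {e} {f : Q → P}

theorem RelAntichain.injOn_of_le (hf : ∀ q, e (f q) ≤ q) {A : Set Q}
    (hA : RelAntichain (· ≤ ·) A) : A.InjOn f := by
  intro a ha b hb hab
  by_contra hne
  exact hA ha hb hne ⟨e (f a), hf a, hab ▸ hf b⟩

theorem RelAntichain.image_of_le (hf : ∀ q, e (f q) ≤ q) {A : Set Q}
    (hA : RelAntichain (· ≤ ·) A) : RelAntichain (· ≤ ·) (f '' A) := by
  rintro _ ⟨a, ha, rfl⟩ _ ⟨b, hb, rfl⟩ hne ⟨r, hra, hrb⟩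
  exact hA ha hb (ne_of_apply_ne f hne)
    ⟨e r, (e.monotone hra).trans (hf a), (e.monotone hrb).trans (hf b)⟩

/-- A poset has the same Souslin number as any of its dense suborders. -/
theorem relSouslin_eq_of_dense (e : P ↪o Q) (hd : ∀ q, ∃ p, e p ≤ q) :
    RelSouslin (· ≤ · : P → P → Prop) = RelSouslin (· ≤ · : Q → Q → Prop) := by
  choose f hf using hd
  unfold RelSouslin
  congr 1
  ext κ
  constructor
  · intro h A hA hκ
    exact h _ (RelAntichain.image_of_le hf hA)
      ((mk_image_eq_of_injOn f A (RelAntichain.injOn_of_le hf hA)).trans hκ)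
  · intro h A hA hκ
    exact h _ (RelAntichain.image_orderEmbedding e (fun q => ⟨f q, hf q⟩) hA)
      ((mk_image_eq e.injective).trans hκ)

/-- The principle ▽ passes from a poset to its dense suborders. -/
theorem RelNabla.of_dense (e : P ↪o Q) (hd : ∀ q, ∃ p, e p ≤ q)
    (h : RelNabla (· ≤ · : Q → Q → Prop)) : RelNabla (· ≤ · : P → P → Prop) := by
  obtain ⟨D, hD, hcard⟩ := h
  have hS := relSouslin_eq_of_dense e hd
  choose f hf using hd
  refine ⟨f '' D, fun p => ?_, fun p => ?_⟩
  · obtain ⟨d, hdD, hdp⟩ := hD (e p)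
    exact ⟨f d, ⟨d, hdD, rfl⟩, e.le_iff_le.1 ((hf d).trans hdp)⟩
  · rw [hS]
    refine lt_of_le_of_lt ((mk_le_mk_of_subset ?_).trans (mk_image_le (f := f))) (hcard (e p))
    rintro _ ⟨⟨d, hdD, rfl⟩, hpd⟩
    exact ⟨d, ⟨hdD, (e.monotone hpd).trans (hf d)⟩, rfl⟩

end DenseEmbedding

theorem LowerSet.disjoint_iff_forall_notMem {P : Type*} [PartialOrder P] {s t : LowerSet P} :
    Disjoint s t ↔ ∀ r ∈ s, r ∉ t := by
  rw [disjoint_iff, SetLike.ext_iff]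
  simp

/-- Principal lower sets in a separative poset are regular. -/
theorem RelSeparative.isRegular_Iic {P : Type*} [PartialOrder P]
    (h : RelSeparative (· ≤ · : P → P → Prop)) (p : P) :
    Heyting.IsRegular (LowerSet.Iic p) := by
  refine le_antisymm (fun q hq => ?_) le_compl_compl
  by_contra hqp
  obtain ⟨r, hrq, hr⟩ := h p q hqp
  have hr' : LowerSet.Iic r ≤ (LowerSet.Iic p)ᶜ := by
    rw [le_compl_iff_disjoint_right, LowerSet.disjoint_iff_forall_notMem]
    exact fun s hsr hsp => hr ⟨s, hsr, hsp⟩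
  have hd : Disjoint (LowerSet.Iic p)ᶜ (LowerSet.Iic p)ᶜᶜ := disjoint_compl_right
  exact LowerSet.disjoint_iff_forall_notMem.1 hd r (hr' le_rfl) (LowerSet.lower _ hrq hq)

/-- The canonical embedding of a separative poset into the nonzero regular lower sets. -/
def RelSeparative.toRegular {P : Type*} [PartialOrder P]
    (h : RelSeparative (· ≤ · : P → P → Prop)) :
    P ↪o { x : Heyting.Regular (LowerSet P) // x ≠ ⊥ } :=
  OrderEmbedding.ofMapLEIff
    (fun p => ⟨⟨LowerSet.Iic p, h.isRegular_Iic p⟩, fun hp =>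
      LowerSet.notMem_bot (a := p) ((congrArg Heyting.Regular.val hp).le
        (show p ∈ LowerSet.Iic p from le_rfl))⟩)
    fun _ _ => LowerSet.Iic_le

theorem RelSeparative.exists_toRegular_le {P : Type*} [PartialOrder P]
    (h : RelSeparative (· ≤ · : P → P → Prop))
    (q : { x : Heyting.Regular (LowerSet P) // x ≠ ⊥ }) : ∃ p, h.toRegular p ≤ q := by
  by_contra! hq
  refine q.2 (Heyting.Regular.coe_injective (LowerSet.ext (Set.eq_empty_iff_forall_notMem.2 ?_)))
  exact fun p hp => hq p (LowerSet.Iic_le.2 hp)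

theorem relSeparative_ne_bot (B : Type*) [BooleanAlgebra B] :
    RelSeparative (fun a b : { x : B // x ≠ ⊥ } => (a : B) ≤ (b : B)) := by
  intro p q hqp
  refine ⟨⟨q \ p, fun h => hqp (sdiff_eq_bot_iff.1 h)⟩, sdiff_le, ?_⟩
  rintro ⟨s, hs, hsp⟩
  exact s.2 (le_bot_iff.1 (disjoint_sdiff_self_left hs hsp))

/-- The principle ▽ holds for every separative poset if and only if it holds for every poset
of nonzero elements of a complete Boolean algebra. -/
theorem nabla_iff_nabla_completeBooleanAlgebra :
    (∀ (P : Type u) (le : P → P → Prop),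
        IsPartialOrder P le → RelSeparative le → RelNabla le) ↔
    (∀ (B : Type u) [CompleteBooleanAlgebra B],
        RelNabla (fun a b : { x : B // x ≠ ⊥ } => (a : B) ≤ (b : B))) := by
  constructor
  · intro h B _
    exact h _ _ (inferInstanceAs (IsPartialOrder { x : B // x ≠ ⊥ } (· ≤ ·)))
      (relSeparative_ne_bot B)
  · intro h P le hle hsep
    let _ : PartialOrder P :=
      { le := le
        le_refl := hle.refl
        le_trans := hle.trans
        le_antisymm := hle.antisymm }
    exact RelNabla.of_dense (RelSeparative.toRegular hsep)
      (RelSeparative.exists_toRegular_le hsep) (h (Heyting.Regular (LowerSet P)))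
end

section
/- Let B be a complete Boolean algebra and let κ be a regular infinite cardinal such that every antichain of nonzero elements of B has cardinality less than κ. If X ⊆ B has cardinality κ, then there is some Y ⊆ X with |X ∖ Y| < κ such that ⋀Y = ⋀(Y ∖ Z) for every Z ⊆ Y with |Z| < κ. -/
open Cardinal

universe u

/-- Every subset of a complete Boolean algebra contains a maximal set of pairwise disjoint
elements. -/
theorem exists_maximal_antichain {B : Type u} [CompleteBooleanAlgebra B] (D : Set B) :
    ∃ A, Maximal (fun A : Set B => A ⊆ D ∧ A.Pairwise fun a b => a ⊓ b = ⊥) A := by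
  refine zorn_subset {A : Set B | A ⊆ D ∧ A.Pairwise fun a b => a ⊓ b = ⊥} fun c hc hchain => ?_
  refine ⟨⋃₀ c, ⟨Set.sUnion_subset fun A hA => (hc hA).1, ?_⟩,
    fun A hA => Set.subset_sUnion_of_mem hA⟩
  exact (Set.pairwise_sUnion hchain.directedOn).2 fun A hA => (hc hA).2

/-- An element of a downward closed family (away from `⊥`) lies below the supremum of every
maximal antichain of that family. -/
theorem le_sSup_of_maximal_antichain {B : Type u} [CompleteBooleanAlgebra B] {D A : Set B}
    (hD : ∀ a ∈ D, ∀ b ≤ a, b ≠ ⊥ → b ∈ D)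
    (hA : Maximal (fun A : Set B => A ⊆ D ∧ A.Pairwise fun a b => a ⊓ b = ⊥) A)
    {d : B} (hd : d ∈ D) : d ≤ sSup A := by
  rw [← sdiff_eq_bot_iff]
  by_contra hne
  have hdisj : ∀ a ∈ A, d \ sSup A ⊓ a = ⊥ := fun a ha =>
    (disjoint_sdiff_self_left.mono_right (le_sSup ha)).eq_bot
  have hins : insert (d \ sSup A) A ⊆ A := by
    refine hA.2 ⟨Set.insert_subset (hD d hd _ sdiff_le hne) hA.1.1, ?_⟩ (Set.subset_insert _ _)
    refine hA.1.2.insert fun a ha _ => ⟨hdisj a ha, ?_⟩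
    rw [inf_comm]
    exact hdisj a ha
  have hself := hdisj _ (hins (Set.mem_insert _ _))
  rw [inf_idem] at hself
  exact hne hself

/-- Let `B` be a complete Boolean algebra satisfying the `κ`-chain condition for a regular
infinite cardinal `κ` (every antichain of nonzero elements has cardinality less than `κ`).
If `X ⊆ B` has cardinality `κ`, then there is `Y ⊆ X` with `|X ∖ Y| < κ` such that
`⋀ Y = ⋀ (Y ∖ Z)` for every `Z ⊆ Y` of cardinality less than `κ`. -/
theorem exists_stable_subset {B : Type u} [CompleteBooleanAlgebra B]
    (κ : Cardinal.{u}) (hreg : κ.IsRegular)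
    (hcc : ∀ A : Set B, (∀ a ∈ A, a ≠ ⊥) → (A.Pairwise fun a b => a ⊓ b = ⊥) → #A < κ)
    (X : Set B) (hX : #X = κ) :
    ∃ Y ⊆ X, #(X \ Y : Set B) < κ ∧
      ∀ Z ⊆ Y, #Z < κ → sInf Y = sInf (Y \ Z) := by
  let D : Set B := {a | a ≠ ⊥ ∧ ∃ Z : Set B, #Z < κ ∧ a ≤ sInf (X \ Z)}
  obtain ⟨A, hA⟩ := exists_maximal_antichain D
  have hAcard : #A < κ := hcc A (fun a ha => (hA.1.1 ha).1) hA.1.2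
  choose W hWcard hW using fun a : A => (hA.1.1 a.2).2
  have hUcard : #(⋃ a, W a : Set B) < κ :=
    (card_iUnion_lt_iff_forall_of_isRegular hreg hAcard).2 hWcard
  refine ⟨X \ ⋃ a, W a, Set.sdiff_subset, ?_, fun Z _ hZ => ?_⟩
  · exact (mk_le_mk_of_subset (by simp)).trans_lt hUcard
  refine le_antisymm (sInf_le_sInf Set.sdiff_subset) ?_
  have hsup : sSup A ≤ sInf (X \ ⋃ a, W a) := sSup_le fun a ha =>
    (hW ⟨a, ha⟩).trans (sInf_le_sInf (Set.sdiff_subset_sdiff_right (Set.subset_iUnion W ⟨a, ha⟩)))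
  refine le_trans ?_ hsup
  rw [Set.sdiff_sdiff]
  by_cases hbot : sInf (X \ ((⋃ a, W a) ∪ Z)) = ⊥
  · rw [hbot]
    exact bot_le
  refine le_sSup_of_maximal_antichain (D := D) ?_ hA ⟨hbot, _, ?_, le_rfl⟩
  · rintro a ⟨_, Z, hZ, haZ⟩ b hba hb
    exact ⟨hb, Z, hZ, hba.trans haZ⟩
  · exact (mk_union_le _ _).trans_lt (add_lt_of_lt hreg.aleph0_le hUcard hZ)
end

section
/- Let μ be the standard product measure on 2^ω. For every open set W ⊆ 2^ω with μ(W) < 1 there exist open sets V₁, V₂ ⊆ 2^ω such that μ(V₁) < 1/2, μ(V₂) < 1/2, and V₁ ∪ V₂ = W. -/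
open MeasureTheory

/-- If all fibres of a measurable map to a finite type have measure at most `ε`, and
`μ W + ε < 1`, then `W` is split by the preimage of some finite set into two parts of measure
less than `1 / 2`. -/
theorem exists_preimage_split_lt_half {α β : Type*} [MeasurableSpace α] [MeasurableSpace β]
    [MeasurableSingletonClass β] [Finite β] (μ : Measure α) {p : α → β} (hp : Measurable p)
    {ε : ENNReal} (hε : ∀ b, μ (p ⁻¹' {b}) ≤ ε) {W : Set α} (hW : μ W + ε < 1) :
    ∃ S : Set β, μ (W ∩ p ⁻¹' S) < 1 / 2 ∧ μ (W \ p ⁻¹' S) < 1 / 2 := by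
  obtain ⟨S, hS, hmax⟩ := (Set.toFinite {S : Set β | μ (W ∩ p ⁻¹' S) < 1 / 2}).exists_maximal
    ⟨∅, by simp⟩
  refine ⟨S, hS, ?_⟩
  by_cases hu : S = Set.univ
  · simp [hu]
  obtain ⟨b, hb⟩ := (Set.ne_univ_iff_exists_notMem S).1 hu
  have hhalf : 1 / 2 ≤ μ (W ∩ p ⁻¹' S) + ε := by
    by_contra! h
    refine hb (hmax (y := insert b S) ?_ (Set.subset_insert b S) (Set.mem_insert b S))
    refine lt_of_le_of_lt ?_ h
    calc μ (W ∩ p ⁻¹' insert b S) ≤ μ ((W ∩ p ⁻¹' S) ∪ p ⁻¹' {b}) := by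
          refine measure_mono ?_
          rintro x ⟨hx, rfl | hxS⟩
          exacts [Or.inr rfl, Or.inl ⟨hx, hxS⟩]
      _ ≤ μ (W ∩ p ⁻¹' S) + ε := (measure_union_le _ _).trans (by gcongr; exact hε b)
  by_contra! h
  refine hW.not_ge ?_
  calc (1 : ENNReal) = 1 / 2 + 1 / 2 := (ENNReal.add_halves 1).symm
    _ ≤ (μ (W ∩ p ⁻¹' S) + ε) + μ (W \ p ⁻¹' S) := add_le_add hhalf h
    _ = μ W + ε := by
      rw [add_right_comm, measure_inter_add_sdiff W (hp S.toFinite.measurableSet)]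

/-- Let `μ` be the standard product (coin-flipping) measure on Cantor space `2^ω`: the
probability measure giving each cylinder determined by finitely many coordinates its natural
measure `(1/2)^n`.  Then every open set `W` of measure less than `1` is the union of two
open sets each of measure less than `1/2`. -/
theorem open_lt_one_eq_union_open_lt_half (μ : Measure (ℕ → Bool))
    (hprob : IsProbabilityMeasure μ)
    (hcyl : ∀ (s : Finset ℕ) (y : ℕ → Bool),
      μ { x : ℕ → Bool | ∀ n ∈ s, x n = y n } = (1 / 2 : ENNReal) ^ s.card)
    (W : Set (ℕ → Bool)) (hW : IsOpen W) (hWμ : μ W < 1) :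
    ∃ V₁ V₂ : Set (ℕ → Bool), IsOpen V₁ ∧ IsOpen V₂ ∧
      μ V₁ < 1 / 2 ∧ μ V₂ < 1 / 2 ∧ V₁ ∪ V₂ = W := by
  obtain ⟨N, hN⟩ := ENNReal.exists_inv_two_pow_lt (tsub_pos_of_lt hWμ).ne'
  let p : (ℕ → Bool) → (Fin N → Bool) := fun x i => x i
  have hp : Continuous p := by fun_prop
  have hfib : ∀ b, μ (p ⁻¹' {b}) ≤ 2⁻¹ ^ N := by
    intro b
    have h := hcyl (Finset.range N) fun n => if hn : n < N then b ⟨n, hn⟩ else false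
    rw [Finset.card_range, one_div] at h
    refine (measure_mono ?_).trans h.le
    rintro x rfl n hn
    simp [p, Finset.mem_range.1 hn]
  obtain ⟨S, h₁, h₂⟩ := exists_preimage_split_lt_half μ hp.measurable hfib
    (lt_tsub_iff_left.1 hN)
  have hS : IsClopen (p ⁻¹' S) := (isClopen_discrete S).preimage hp
  exact ⟨_, _, hW.inter hS.isOpen, hW.sdiff hS.isClosed, h₁, h₂, Set.inter_union_sdiff W _⟩
end
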